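/- arXiv:2501.09574 — 7 statements merged into one kernel-verified Lean document; each statement's English description precedes it below -/
import Mathlib

section
/- Let N ≥ 2 be an integer and let P be the N×N real matrix with entries P_{1,1} = P_{N,N} = 3/4, P_{μ,μ} = 1/2 for 1 < μ < N, P_{μ,ν} = 1/4 whenever |μ−ν| = 1, and P_{μ,ν} = 0 otherwise. Then for every natural number t and all 1 ≤ i, μ ≤ N: (P^t)_{i,μ} = 1/N + (2/N) · Σ_{k=1}^{N−1} cos((i−1/2)πk/N) · cos((μ−1/2)πk/N) · cos(πk/(2N))^{2t}. -/
open Real Finset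

/-- Applying the transition matrix to the restriction of a
function on `ℤ` that is symmetric about both ends of the path gives the lazy walk on `ℤ`. -/
theorem sum_reflecting_mul (N : ℕ) (hN : 2 ≤ N) (P : Matrix (Fin N) (Fin N) ℝ)
    (hP : ∀ i j : Fin N,
      P i j =
        if i = j then
          (if (i : ℕ) = 0 ∨ (i : ℕ) = N - 1 then (3 : ℝ) / 4 else 1 / 2)
        else if (i : ℕ) + 1 = (j : ℕ) ∨ (j : ℕ) + 1 = (i : ℕ) then (1 : ℝ) / 4
        else 0)
    (g : ℤ → ℝ) (h0 : g (-1) = g 0) (h1 : g N = g (N - 1)) (i : Fin N) :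
    ∑ j, P i j * g (j : ℕ) =
      1 / 2 * g (i : ℕ) + 1 / 4 * g ((i : ℕ) + 1) + 1 / 4 * g ((i : ℕ) - 1) := by
  obtain ⟨i, hi⟩ := i
  have hsplit : ∀ j : Fin N, P ⟨i, hi⟩ j * g (j : ℕ) =
      (if i = (j : ℕ) then (if i = 0 ∨ i = N - 1 then (3 : ℝ) / 4 else 1 / 2) * g (j : ℕ) else 0)
      + (if i + 1 = (j : ℕ) then 1 / 4 * g (j : ℕ) else 0)
      + (if 0 < i ∧ i - 1 = (j : ℕ) then 1 / 4 * g (j : ℕ) else 0) := by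
    intro j
    rw [hP]
    simp only [Fin.ext_iff]
    split_ifs <;> first | omega | ring
  simp only [hsplit, sum_add_distrib]
  rw [Fin.sum_univ_eq_sum_range (fun j => if i = j then
      (if i = 0 ∨ i = N - 1 then (3 : ℝ) / 4 else 1 / 2) * g (j : ℕ) else 0),
    Fin.sum_univ_eq_sum_range (fun j => if i + 1 = j then 1 / 4 * g (j : ℕ) else 0),
    Fin.sum_univ_eq_sum_range (fun j => if 0 < i ∧ i - 1 = j then 1 / 4 * g (j : ℕ) else 0)]
  simp only [ite_and, sum_ite_eq, mem_range, hi, if_true]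
  rcases Nat.eq_zero_or_pos i with rfl | hpos
  · have : 1 < N := by omega
    simp [this, h0]
    ring
  · have hcast : ((i - 1 : ℕ) : ℤ) = (i : ℤ) - 1 := by omega
    have hlt : i - 1 < N := by omega
    by_cases hlast : i = N - 1
    · have hi1 : ((i : ℕ) : ℤ) + 1 = N := by omega
      have hi2 : (N : ℤ) - 1 = i := by omega
      have hnot : ¬ i + 1 < N := by omega
      rw [hi2] at h1
      simp [hnot, hpos, hlt, hcast, hi1, h1, ← hlast]
      ring
    · have hin : i + 1 < N := by omega
      simp [hin, hpos, hlt, hcast, hlast, hpos.ne']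

/-- The functions `j ↦ cos ((j + 1/2) π k / N)` are eigenvectors of the walk. -/
theorem sum_reflecting_mul_cos (N : ℕ) (hN : 2 ≤ N) (P : Matrix (Fin N) (Fin N) ℝ)
    (hP : ∀ i j : Fin N,
      P i j =
        if i = j then
          (if (i : ℕ) = 0 ∨ (i : ℕ) = N - 1 then (3 : ℝ) / 4 else 1 / 2)
        else if (i : ℕ) + 1 = (j : ℕ) ∨ (j : ℕ) + 1 = (i : ℕ) then (1 : ℝ) / 4
        else 0)
    (k : ℕ) (i : Fin N) :
    ∑ j : Fin N, P i j * Real.cos (((j : ℝ) + 1 / 2) * π * k / N) =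
      Real.cos (π * k / (2 * N)) ^ 2 * Real.cos (((i : ℝ) + 1 / 2) * π * k / N) := by
  have hN0 : (N : ℝ) ≠ 0 := by positivity
  have h := sum_reflecting_mul N hN P hP
    (fun z : ℤ => Real.cos (((z : ℝ) + 1 / 2) * π * k / N)) ?_ ?_ i
  · push_cast at h
    rw [h, Real.cos_sq,
      show ((i : ℝ) + 1 + 1 / 2) * π * k / N
        = ((i : ℝ) + 1 / 2) * π * k / N + π * k / N by ring,
      show ((i : ℝ) - 1 + 1 / 2) * π * k / N
        = ((i : ℝ) + 1 / 2) * π * k / N - π * k / N by ring,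
      show 2 * (π * k / (2 * N)) = π * k / N by field_simp,
      Real.cos_add, Real.cos_sub]
    ring
  · rw [← Real.cos_neg]
    push_cast
    congr 1
    ring
  · rw [← Real.cos_neg, ← Real.cos_add_nat_mul_two_pi _ k]
    push_cast
    congr 1
    field_simp
    ring

/-- The Lagrange identity for a sum of cosines. -/
theorem two_mul_sin_half_mul_sum_cos (x : ℝ) (n : ℕ) :
    2 * Real.sin (x / 2) * ∑ k ∈ Icc 1 n, Real.cos (k * x) =
      Real.sin (n * x + x / 2) - Real.sin (x / 2) := by
  induction n with
  | zero => simp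
  | succ n ih =>
    rw [sum_Icc_succ_top (by omega), mul_add, ih]
    push_cast
    rw [show (n : ℝ) * x + x / 2 = ((n : ℝ) + 1) * x - x / 2 by ring, Real.sin_sub, Real.sin_add]
    ring

theorem sum_cos_int_mul_pi_div (N : ℕ) (hN : 1 ≤ N) (m : ℤ) (hm : m ≠ 0)
    (hlt : |m| < 2 * (N : ℤ)) :
    ∑ k ∈ Icc 1 (N - 1), Real.cos (k * (m * π / N)) = (-1 - (-1) ^ m) / 2 := by
  have hN0 : (0 : ℝ) < N := by positivity
  have hs : Real.sin (m * π / N / 2) ≠ 0 := by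
    rw [Ne, Real.sin_eq_zero_iff]
    rintro ⟨n, hn⟩
    have h : (m : ℝ) = n * (2 * N) := by
      have := Real.pi_ne_zero
      field_simp at hn
      linarith
    have h' : m = n * (2 * N) := by exact_mod_cast h
    have hd : 2 * (N : ℤ) ∣ m := ⟨n, by rw [h']; ring⟩
    exact hm (Int.eq_zero_of_abs_lt_dvd hd hlt)
  have h := two_mul_sin_half_mul_sum_cos (m * π / N) (N - 1)
  rw [show ((N - 1 : ℕ) : ℝ) * (m * π / N) + m * π / N / 2 = m * π - m * π / N / 2 by
      rw [Nat.cast_sub hN]; field_simp; push_cast; ring,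
    Real.sin_sub, Real.sin_int_mul_pi, Real.cos_int_mul_pi] at h
  apply mul_left_cancel₀ hs
  linarith

/-- Orthogonality of the discrete cosine basis in the frequency variable. -/
theorem dct_orthogonality (N : ℕ) (i j : Fin N) :
    1 / (N : ℝ) + (2 / (N : ℝ)) *
      ∑ k ∈ Icc 1 (N - 1), Real.cos (((i : ℝ) + 1 / 2) * π * k / N) *
        Real.cos (((j : ℝ) + 1 / 2) * π * k / N) = if i = j then 1 else 0 := by
  obtain ⟨i, hi⟩ := i
  obtain ⟨j, hj⟩ := j
  have hN : 1 ≤ N := by omega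
  have hN0 : (N : ℝ) ≠ 0 := by positivity
  have hprod : 2 * ∑ k ∈ Icc 1 (N - 1), Real.cos (((i : ℝ) + 1 / 2) * π * k / N) *
        Real.cos (((j : ℝ) + 1 / 2) * π * k / N) =
      ∑ k ∈ Icc 1 (N - 1), Real.cos (k * (((i - j : ℤ) : ℝ) * π / N)) +
      ∑ k ∈ Icc 1 (N - 1), Real.cos (k * (((i + j + 1 : ℤ) : ℝ) * π / N)) := by
    rw [mul_sum, ← sum_add_distrib]
    refine sum_congr rfl fun k _ => ?_
    rw [← mul_assoc, Real.two_mul_cos_mul_cos]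
    push_cast
    congr 2 <;> ring
  rw [sum_cos_int_mul_pi_div N hN (i + j + 1) (by omega) (by rw [abs_lt]; omega)] at hprod
  rw [div_mul_eq_mul_div, hprod]
  simp only [Fin.mk.injEq]
  by_cases hij : i = j
  · subst hij
    have hodd : Odd ((i : ℤ) + i + 1) := ⟨i, by ring⟩
    rw [hodd.neg_one_zpow]
    simp [Nat.cast_sub hN]
    field_simp
    ring
  · rw [sum_cos_int_mul_pi_div N hN (i - j) (by omega) (by rw [abs_lt]; omega),
      show (i : ℤ) + j + 1 = (i - j) + (2 * j + 1) by ring, zpow_add₀ (by norm_num),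
      (show Odd (2 * (j : ℤ) + 1) from ⟨j, rfl⟩).neg_one_zpow, if_neg hij]
    field_simp
    ring

/-- Exact propagator of the symmetric lazy random walk with reflecting
boundaries on a path of `N ≥ 2` sites.  `P` is the transition matrix (indexed
by `Fin N`, so site `μ` in 1-based notation corresponds to index `μ - 1`):
staying probability `1/2` in the interior and `3/4` at the two ends, and
probability `1/4` to move to each neighbor.  Then for every number of steps
`t` and all sites `i, μ`,
`(P^t)_{i,μ} = 1/N + (2/N) Σ_{k=1}^{N-1} cos((i-1/2)πk/N) cos((μ-1/2)πk/N) cos(πk/(2N))^{2t}`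
(written below with 0-based indices, so `i - 1/2` becomes `(i : ℝ) + 1/2`). -/
theorem stmt_7 (N : ℕ) (hN : 2 ≤ N) (P : Matrix (Fin N) (Fin N) ℝ)
    (hP : ∀ i j : Fin N,
      P i j =
        if i = j then
          (if (i : ℕ) = 0 ∨ (i : ℕ) = N - 1 then (3 : ℝ) / 4 else 1 / 2)
        else if (i : ℕ) + 1 = (j : ℕ) ∨ (j : ℕ) + 1 = (i : ℕ) then (1 : ℝ) / 4
        else 0)
    (t : ℕ) (i μ : Fin N) :
    (P ^ t) i μ =
      1 / (N : ℝ) + (2 / (N : ℝ)) *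
        ∑ k ∈ Finset.Icc 1 (N - 1),
          Real.cos (((i : ℝ) + 1 / 2) * π * k / N) *
            Real.cos (((μ : ℝ) + 1 / 2) * π * k / N) *
              Real.cos (π * k / (2 * N)) ^ (2 * t) := by
  induction t generalizing i with
  | zero => simpa [Matrix.one_apply] using (dct_orthogonality N i μ).symm
  | succ t ih =>
    have hrow : ∑ j, P i j = 1 := by simpa using sum_reflecting_mul_cos N hN P hP 0 i
    rw [pow_succ', Matrix.mul_apply]
    simp only [ih, mul_add, sum_add_distrib, ← sum_mul, hrow, one_mul]
    congr 1
    simp only [mul_sum]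
    rw [sum_comm]
    refine sum_congr rfl fun k _ => ?_
    calc _ = (∑ j : Fin N, P i j * Real.cos (((j : ℝ) + 1 / 2) * π * k / N)) *
          (2 / N * (Real.cos (((μ : ℝ) + 1 / 2) * π * k / N) *
            Real.cos (π * k / (2 * N)) ^ (2 * t))) := by
          rw [sum_mul]
          exact sum_congr rfl fun j _ => by ring
      _ = _ := by
          rw [sum_reflecting_mul_cos N hN P hP]
          ring
end

section
/- For all integers N ≥ 1, 1 ≤ i, μ ≤ N, and every natural number t: ℒ_i(μ,t) ≥ 0, where ℒ_i(μ,t) := 1/N + (2/N) · Σ_{k=1}^{N−1} cos((μ−1/2)πk/N) · cos((i−1/2)πk/N) · cos(πk/(2N))^{2t}. -/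
open Real Finset

/-- The exact propagator `ℒ_i(μ, t)` of the symmetric lazy random walk with
reflecting boundaries on `N` sites. -/
noncomputable def Lwalk (N i μ t : ℕ) : ℝ :=
  1 / (N : ℝ) + (2 / (N : ℝ)) *
    ∑ k ∈ Finset.Icc 1 (N - 1),
      Real.cos (((μ : ℝ) - 1 / 2) * π * k / N) *
        Real.cos (((i : ℝ) - 1 / 2) * π * k / N) *
          Real.cos (π * k / (2 * N)) ^ (2 * t)

/-- The sum of `cos (π m k / N)` over a full period of `k` is `2N` or `0`. -/
lemma sum_cos_full_period_nonneg (N : ℕ) (hN : 1 ≤ N) (m : ℤ) :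
    0 ≤ ∑ k ∈ Finset.range (2 * N), Real.cos ((m : ℝ) * (π * k / N)) := by
  have hN0 : (N : ℂ) ≠ 0 := by exact_mod_cast (by omega : N ≠ 0)
  set z : ℂ := Complex.exp (((m : ℝ) * (π / N) : ℝ) * Complex.I) with hz
  have hpow (k : ℕ) : Real.cos ((m : ℝ) * (π * k / N)) = (z ^ k).re := by
    rw [hz, ← Complex.exp_nat_mul, ← Complex.exp_ofReal_mul_I_re]
    congr 2
    push_cast
    ring
  have hone : z ^ (2 * N) = 1 := by
    rw [hz, ← Complex.exp_nat_mul, Complex.exp_eq_one_iff]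
    refine ⟨m, ?_⟩
    push_cast
    field_simp
  simp_rw [hpow]
  rw [← Complex.re_sum]
  by_cases h : z = 1
  · simp [h]
  · simp [geom_sum_eq h, hone]

/-- The lazy walk on the cycle of length `2N` has a nonnegative propagator. -/
lemma sum_cos_mul_cos_pow_nonneg (N : ℕ) (hN : 1 ≤ N) (t : ℕ) (m : ℤ) :
    0 ≤ ∑ k ∈ Finset.range (2 * N),
      Real.cos ((m : ℝ) * (π * k / N)) * Real.cos (π * k / (2 * N)) ^ (2 * t) := by
  induction t generalizing m with
  | zero => simpa using sum_cos_full_period_nonneg N hN m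
  | succ t ih =>
    have key (k : ℕ) :
        Real.cos ((m : ℝ) * (π * k / N)) * Real.cos (π * k / (2 * N)) ^ (2 * (t + 1)) =
          1 / 2 * (Real.cos ((m : ℝ) * (π * k / N)) * Real.cos (π * k / (2 * N)) ^ (2 * t)) +
          1 / 4 * (Real.cos (((m + 1 : ℤ) : ℝ) * (π * k / N)) *
            Real.cos (π * k / (2 * N)) ^ (2 * t)) +
          1 / 4 * (Real.cos (((m - 1 : ℤ) : ℝ) * (π * k / N)) *
            Real.cos (π * k / (2 * N)) ^ (2 * t)) := by
      have hsq : Real.cos (π * k / (2 * N)) ^ 2 = 1 / 2 + Real.cos (π * k / N) / 2 := by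
        rw [Real.cos_sq]
        congr 3
        ring
      have hadd : Real.cos (((m + 1 : ℤ) : ℝ) * (π * k / N)) +
          Real.cos (((m - 1 : ℤ) : ℝ) * (π * k / N)) =
          2 * Real.cos ((m : ℝ) * (π * k / N)) * Real.cos (π * k / N) := by
        push_cast
        rw [add_mul, sub_mul, one_mul, Real.cos_add, Real.cos_sub]
        ring
      rw [mul_add, pow_add, mul_one, hsq]
      linear_combination (-1 / 4 * Real.cos (π * k / (2 * N)) ^ (2 * t)) * hadd
    simp_rw [key, Finset.sum_add_distrib, ← Finset.mul_sum]
    have h₀ := ih m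
    have h₁ := ih (m + 1)
    have h₂ := ih (m - 1)
    positivity

/-- A sum over a full period of a function symmetric under `k ↦ 2N - k`. -/
lemma sum_range_two_mul_of_symm (N : ℕ) (hN : 1 ≤ N) (f : ℕ → ℝ)
    (hf : ∀ k, k ≤ 2 * N → f (2 * N - k) = f k) :
    ∑ k ∈ Finset.range (2 * N), f k = f 0 + f N + 2 * ∑ k ∈ Finset.Icc 1 (N - 1), f k := by
  obtain ⟨n, rfl⟩ : ∃ n, N = n + 1 := ⟨N - 1, by omega⟩
  have hIcc : ∑ k ∈ Finset.Icc 1 n, f k = ∑ j ∈ Finset.range n, f (j + 1) := by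
    rw [Finset.range_eq_Ico, Finset.sum_Ico_add' f 0 n 1]
    rfl
  have hrefl : ∑ j ∈ Finset.range n, f (n + 1 + (j + 1)) =
      ∑ j ∈ Finset.range n, f (j + 1) := by
    rw [← Finset.sum_range_reflect]
    refine Finset.sum_congr rfl fun j hj => ?_
    have hj := Finset.mem_range.mp hj
    rw [← hf (j + 1) (by omega)]
    congr 1
    omega
  rw [two_mul, Finset.sum_range_add, Finset.sum_range_succ', Finset.sum_range_succ' _ n, hrefl,
    Nat.add_sub_cancel, hIcc, add_zero]
  ring

/-- Half-integer cosine modes are antisymmetric under `k ↦ 2N - k`. -/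
lemma cos_half_integer_mode_reflect (N a k : ℕ) (hN : 1 ≤ N) (hk : k ≤ 2 * N) :
    Real.cos (((a : ℝ) - 1 / 2) * π * (2 * N - k : ℕ) / N) =
      -Real.cos (((a : ℝ) - 1 / 2) * π * k / N) := by
  have hN0 : (N : ℝ) ≠ 0 := by exact_mod_cast (by omega : N ≠ 0)
  have h : ((a : ℝ) - 1 / 2) * π * (2 * N - k : ℕ) / N =
      a * (2 * π) - (((a : ℝ) - 1 / 2) * π * k / N + π) := by
    rw [Nat.cast_sub hk]
    push_cast
    field_simp
    ring
  rw [h, Real.cos_nat_mul_two_pi_sub, Real.cos_add_pi]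

/-- For all `N ≥ 1`, `1 ≤ i, μ ≤ N` and every `t`, the propagator of the lazy
random walk is nonnegative: `ℒ_i(μ, t) ≥ 0`. -/
theorem stmt_9 (N i μ t : ℕ) (hN : 1 ≤ N) (hi1 : 1 ≤ i) (hiN : i ≤ N)
    (hμ1 : 1 ≤ μ) (hμN : μ ≤ N) :
    0 ≤ Lwalk N i μ t := by
  have hN0 : (N : ℝ) ≠ 0 := by exact_mod_cast (by omega : N ≠ 0)
  obtain ⟨f, hf⟩ : ∃ f : ℕ → ℝ, f = fun (k : ℕ) =>
    Real.cos (((μ : ℝ) - 1 / 2) * π * k / N) * Real.cos (((i : ℝ) - 1 / 2) * π * k / N) *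
      Real.cos (π * k / (2 * N)) ^ (2 * t) := ⟨_, rfl⟩
  have hsymm (k : ℕ) (hk : k ≤ 2 * N) : f (2 * N - k) = f k := by
    have hlazy : Real.cos (π * (2 * N - k : ℕ) / (2 * N)) = -Real.cos (π * k / (2 * N)) := by
      rw [← Real.cos_pi_sub]
      congr 1
      rw [Nat.cast_sub hk]
      push_cast
      field_simp
    simp only [hf]
    rw [cos_half_integer_mode_reflect N μ k hN hk, cos_half_integer_mode_reflect N i k hN hk,
      hlazy, (even_two_mul t).neg_pow, neg_mul_neg]
  have hzero : f 0 = 1 := by simp [hf]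
  have hmid : f N = 0 := by
    have : Real.cos (((μ : ℝ) - 1 / 2) * π * N / N) = 0 := by
      rw [mul_div_cancel_right₀ _ hN0, sub_mul, one_div_mul_eq_div, Real.cos_sub_pi_div_two,
        Real.sin_nat_mul_pi]
    simp only [hf, this, zero_mul]
  have hsplit (k : ℕ) : f k =
      1 / 2 * (Real.cos ((((μ : ℤ) - i : ℤ) : ℝ) * (π * k / N)) *
        Real.cos (π * k / (2 * N)) ^ (2 * t)) +
      1 / 2 * (Real.cos ((((μ : ℤ) + i - 1 : ℤ) : ℝ) * (π * k / N)) *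
        Real.cos (π * k / (2 * N)) ^ (2 * t)) := by
    have hsub : (((μ : ℤ) - i : ℤ) : ℝ) * (π * k / N) =
        ((μ : ℝ) - 1 / 2) * π * k / N - ((i : ℝ) - 1 / 2) * π * k / N := by
      push_cast
      ring
    have hadd : (((μ : ℤ) + i - 1 : ℤ) : ℝ) * (π * k / N) =
        ((μ : ℝ) - 1 / 2) * π * k / N + ((i : ℝ) - 1 / 2) * π * k / N := by
      push_cast
      ring
    simp only [hf]
    rw [hsub, hadd, Real.cos_sub, Real.cos_add]
    ring
  have hnonneg : 0 ≤ ∑ k ∈ Finset.range (2 * N), f k := by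
    simp_rw [hsplit, Finset.sum_add_distrib, ← Finset.mul_sum]
    have h₁ := sum_cos_mul_cos_pow_nonneg N hN t ((μ : ℤ) - i)
    have h₂ := sum_cos_mul_cos_pow_nonneg N hN t ((μ : ℤ) + i - 1)
    positivity
  have hL : Lwalk N i μ t = 1 / (N : ℝ) * ∑ k ∈ Finset.range (2 * N), f k := by
    rw [sum_range_two_mul_of_symm N hN f hsymm, hzero, hmid, Lwalk, hf]
    ring
  rw [hL]
  positivity
end

section
/- For all integers N ≥ 1, 1 ≤ i, j ≤ N, and every natural number t: Σ_{μ=1}^{N} ℒ_i(μ,t) · ℒ_j(μ,t) = 1/N + (1/N) · Σ_{k=1}^{N−1} [cos((i−j)kπ/N) + cos((i+j−1)kπ/N)] · cos(πk/(2N))^{4t}, where ℒ_i(μ,t) := 1/N + (2/N) · Σ_{k=1}^{N−1} cos((μ−1/2)πk/N) · cos((i−1/2)πk/N) · cos(πk/(2N))^{2t}. -/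
open Real Finset

/-- Telescoping form of the sum of a cosine over half-integer multiples of an angle. -/
theorem two_mul_sin_half_mul_sum_cos_s10 (N : ℕ) (x : ℝ) :
    2 * sin (x / 2) * ∑ μ ∈ Finset.Icc 1 N, cos (((μ : ℝ) - 1 / 2) * x) = sin (N * x) := by
  induction N with
  | zero => simp
  | succ n ih =>
    rw [Finset.sum_Icc_succ_top (by omega), mul_add, ih]
    have h₁ : ((n + 1 : ℕ) : ℝ) * x = (n + 1 / 2) * x + x / 2 := by push_cast; ring
    have h₂ : (n : ℝ) * x = (n + 1 / 2) * x - x / 2 := by ring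
    have h₃ : (((n + 1 : ℕ) : ℝ) - 1 / 2) * x = (n + 1 / 2) * x := by push_cast; ring
    rw [h₁, h₂, h₃, sin_add, sin_sub]
    ring

theorem sum_cos_half_integer_eq_zero {N : ℕ} {m : ℤ} (hm : m ≠ 0) (hmN : |m| < 2 * N) :
    ∑ μ ∈ Finset.Icc 1 N, cos (((μ : ℝ) - 1 / 2) * (π * m / N)) = 0 := by
  have hN : (0 : ℝ) < N := by
    have : (0 : ℤ) < N := by have := abs_nonneg m; omega
    exact_mod_cast this
  have hm' : (m : ℝ) ≠ 0 := by exact_mod_cast hm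
  obtain ⟨hlo, hhi⟩ := abs_lt.mp hmN
  have hlo' : -(2 * N : ℝ) < m := by exact_mod_cast hlo
  have hhi' : (m : ℝ) < 2 * N := by exact_mod_cast hhi
  have hsin : sin (π * m / N / 2) ≠ 0 := by
    rw [Ne, sin_eq_zero_iff_of_lt_of_lt]
    · have := pi_ne_zero
      positivity
    · rw [div_div, lt_div_iff₀ (by positivity)]
      nlinarith [pi_pos]
    · rw [div_div, div_lt_iff₀ (by positivity)]
      nlinarith [pi_pos]
  have h := two_mul_sin_half_mul_sum_cos_s10 N (π * m / N)
  rw [show (N : ℝ) * (π * m / N) = m * π by field_simp, sin_int_mul_pi] at h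
  exact (mul_eq_zero.mp h).resolve_left (mul_ne_zero two_ne_zero hsin)

theorem sum_cos_mode_eq_zero {N k : ℕ} (hk : k ∈ Finset.Icc 1 (N - 1)) :
    ∑ μ ∈ Finset.Icc 1 N, cos (((μ : ℝ) - 1 / 2) * π * k / N) = 0 := by
  rw [Finset.mem_Icc] at hk
  rw [← sum_cos_half_integer_eq_zero (N := N) (m := k) (by omega) (by rw [abs_lt]; omega)]
  refine Finset.sum_congr rfl fun μ _ => ?_
  congr 1
  push_cast
  ring

/-- Discrete orthogonality of the nonconstant reflecting modes. -/
theorem sum_cos_mode_mul_cos_mode {N k l : ℕ} (hk : k ∈ Finset.Icc 1 (N - 1))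
    (hl : l ∈ Finset.Icc 1 (N - 1)) :
    ∑ μ ∈ Finset.Icc 1 N,
        cos (((μ : ℝ) - 1 / 2) * π * k / N) * cos (((μ : ℝ) - 1 / 2) * π * l / N) =
      if k = l then (N : ℝ) / 2 else 0 := by
  rw [Finset.mem_Icc] at hk hl
  have hprod (μ : ℕ) :
      cos (((μ : ℝ) - 1 / 2) * π * k / N) * cos (((μ : ℝ) - 1 / 2) * π * l / N) =
        (cos (((μ : ℝ) - 1 / 2) * (π * ((k - l : ℤ) : ℝ) / N)) +
          cos (((μ : ℝ) - 1 / 2) * (π * ((k + l : ℤ) : ℝ) / N))) / 2 := by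
    have h₁ : ((μ : ℝ) - 1 / 2) * (π * ((k - l : ℤ) : ℝ) / N) =
        ((μ : ℝ) - 1 / 2) * π * k / N - ((μ : ℝ) - 1 / 2) * π * l / N := by push_cast; ring
    have h₂ : ((μ : ℝ) - 1 / 2) * (π * ((k + l : ℤ) : ℝ) / N) =
        ((μ : ℝ) - 1 / 2) * π * k / N + ((μ : ℝ) - 1 / 2) * π * l / N := by push_cast; ring
    rw [h₁, h₂, cos_sub, cos_add]
    ring
  simp_rw [hprod]
  rw [← Finset.sum_div, Finset.sum_add_distrib,
    sum_cos_half_integer_eq_zero (m := k + l) (by omega) (by rw [abs_lt]; omega)]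
  split_ifs with hkl
  · simp [hkl]
  · rw [sum_cos_half_integer_eq_zero (by omega) (by rw [abs_lt]; omega)]
    simp

/-- Parseval's identity for expansions in the nonconstant reflecting modes. -/
theorem sum_cos_expansion_mul_cos_expansion (N : ℕ) (a b : ℕ → ℝ) :
    ∑ μ ∈ Finset.Icc 1 N,
        (∑ k ∈ Finset.Icc 1 (N - 1), cos (((μ : ℝ) - 1 / 2) * π * k / N) * a k) *
          (∑ k ∈ Finset.Icc 1 (N - 1), cos (((μ : ℝ) - 1 / 2) * π * k / N) * b k) =
      (N : ℝ) / 2 * ∑ k ∈ Finset.Icc 1 (N - 1), a k * b k := by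
  simp_rw [Finset.sum_mul_sum]
  rw [Finset.sum_comm, Finset.mul_sum]
  refine Finset.sum_congr rfl fun k hk => ?_
  rw [Finset.sum_comm]
  have hterm : ∀ l ∈ Finset.Icc 1 (N - 1),
      ∑ μ ∈ Finset.Icc 1 N, cos (((μ : ℝ) - 1 / 2) * π * k / N) * a k *
          (cos (((μ : ℝ) - 1 / 2) * π * l / N) * b l) =
        if k = l then (N : ℝ) / 2 * (a k * b l) else 0 := fun l hl => by
    simp_rw [mul_mul_mul_comm _ (a k)]
    rw [← Finset.sum_mul, sum_cos_mode_mul_cos_mode hk hl, ite_mul, zero_mul]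
  rw [Finset.sum_congr rfl hterm, Finset.sum_ite_eq, if_pos hk]

theorem sum_cos_expansion_eq_zero (N : ℕ) (a : ℕ → ℝ) :
    ∑ μ ∈ Finset.Icc 1 N,
      ∑ k ∈ Finset.Icc 1 (N - 1), cos (((μ : ℝ) - 1 / 2) * π * k / N) * a k = 0 := by
  rw [Finset.sum_comm]
  refine Finset.sum_eq_zero fun k hk => ?_
  rw [← Finset.sum_mul, sum_cos_mode_eq_zero hk, zero_mul]

/-- For all `N ≥ 1`, `1 ≤ i, j ≤ N` and every `t`, the diagonal collision sum
of two independent lazy walkers has the closed form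
`Σ_{μ=1}^{N} ℒ_i(μ,t) ℒ_j(μ,t)
  = 1/N + (1/N) Σ_{k=1}^{N-1} [cos((i-j)kπ/N) + cos((i+j-1)kπ/N)] cos(πk/(2N))^{4t}`. -/
theorem stmt_10 (N i j t : ℕ) (hN : 1 ≤ N) (hi1 : 1 ≤ i) (hiN : i ≤ N)
    (hj1 : 1 ≤ j) (hjN : j ≤ N) :
    ∑ μ ∈ Finset.Icc 1 N, Lwalk N i μ t * Lwalk N j μ t =
      1 / (N : ℝ) + (1 / (N : ℝ)) *
        ∑ k ∈ Finset.Icc 1 (N - 1),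
          (Real.cos (((i : ℝ) - (j : ℝ)) * k * π / N) +
              Real.cos (((i : ℝ) + (j : ℝ) - 1) * k * π / N)) *
            Real.cos (π * k / (2 * N)) ^ (4 * t) := by
  have hN0 : (N : ℝ) ≠ 0 := by positivity
  simp only [Lwalk, mul_assoc (cos _)]
  set a : ℕ → ℝ := fun k => cos (((i : ℝ) - 1 / 2) * π * k / N) *
    cos (π * k / (2 * N)) ^ (2 * t) with ha
  set b : ℕ → ℝ := fun k => cos (((j : ℝ) - 1 / 2) * π * k / N) *
    cos (π * k / (2 * N)) ^ (2 * t) with hb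
  have hexpand (A B : ℝ) : (1 / (N : ℝ) + 2 / N * A) * (1 / (N : ℝ) + 2 / N * B) =
      1 / (N : ℝ) ^ 2 + 2 / (N : ℝ) ^ 2 * A + 2 / (N : ℝ) ^ 2 * B + 4 / (N : ℝ) ^ 2 * (A * B) := by
    ring
  simp_rw [hexpand, Finset.sum_add_distrib, ← Finset.mul_sum]
  rw [sum_cos_expansion_eq_zero N a, sum_cos_expansion_eq_zero N b,
    sum_cos_expansion_mul_cos_expansion N a b]
  have hab : ∑ k ∈ Finset.Icc 1 (N - 1),
      (cos (((i : ℝ) - (j : ℝ)) * k * π / N) + cos (((i : ℝ) + (j : ℝ) - 1) * k * π / N)) *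
        cos (π * k / (2 * N)) ^ (4 * t) = 2 * ∑ k ∈ Finset.Icc 1 (N - 1), a k * b k := by
    rw [Finset.mul_sum]
    refine Finset.sum_congr rfl fun k _ => ?_
    have h₁ : ((i : ℝ) - j) * k * π / N =
        ((i : ℝ) - 1 / 2) * π * k / N - ((j : ℝ) - 1 / 2) * π * k / N := by ring
    have h₂ : ((i : ℝ) + j - 1) * k * π / N =
        ((i : ℝ) - 1 / 2) * π * k / N + ((j : ℝ) - 1 / 2) * π * k / N := by ring
    rw [h₁, h₂, cos_sub, cos_add, show 4 * t = 2 * t + 2 * t by ring, pow_add]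
    simp only [ha, hb]
    ring
  rw [hab]
  simp only [Finset.sum_const, Nat.card_Icc, nsmul_eq_mul, Nat.add_sub_cancel]
  field_simp
  ring
end

section
/- Let N ≥ 2 be an integer and let p, q : {1,…,N} → ℝ be nonnegative functions. Define the lazy-walk update (Tp)(μ) := (1/4)p(μ−1) + (1/2)p(μ) + (1/4)p(μ+1) for 1 < μ < N, (Tp)(1) := (3/4)p(1) + (1/4)p(2), and (Tp)(N) := (3/4)p(N) + (1/4)p(N−1), and similarly for Tq. Then Σ_{μ=1}^{N} (Tp)(μ)(Tq)(μ) ≥ (3/8) Σ_{μ=1}^{N} p(μ)q(μ) + (1/4) Σ_{μ=1}^{N−1} (p(μ)q(μ+1) + p(μ+1)q(μ)). -/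
open Finset

/-- One step of the symmetric lazy random walk with reflecting boundaries on
the sites `{1, …, N}`, applied to a function `p` on the sites. -/
noncomputable def lazyUpdate (N : ℕ) (p : ℕ → ℝ) (μ : ℕ) : ℝ :=
  if μ = 1 then (3 / 4) * p 1 + (1 / 4) * p 2
  else if μ = N then (3 / 4) * p N + (1 / 4) * p (N - 1)
  else (1 / 4) * p (μ - 1) + (1 / 2) * p μ + (1 / 4) * p (μ + 1)

/-- Truncated form of the overlap bound, with the boundary terms created by cutting the sum off
before the last site. -/
lemma lazyUpdate_partial_overlap (n : ℕ) (p q : ℕ → ℝ)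
    (hp : ∀ μ ∈ Finset.Icc 1 (n + 2), 0 ≤ p μ)
    (hq : ∀ μ ∈ Finset.Icc 1 (n + 2), 0 ≤ q μ) (k : ℕ) (hk : k ≤ n) :
    (3 / 8) * ∑ μ ∈ Finset.Icc 1 (k + 1), p μ * q μ +
        (1 / 4) * ∑ μ ∈ Finset.Icc 1 k, (p μ * q (μ + 1) + p (μ + 1) * q μ) -
        (1 / 16) * (p (k + 1) * q (k + 1)) + (1 / 16) * (p (k + 2) * q (k + 2)) +
        (1 / 8) * (p (k + 1) * q (k + 2) + p (k + 2) * q (k + 1)) ≤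
      ∑ μ ∈ Finset.Icc 1 (k + 1), lazyUpdate (n + 2) p μ * lazyUpdate (n + 2) q μ := by
  have hpq : ∀ i j, i ≤ n + 1 → j ≤ n + 1 → 0 ≤ p (i + 1) * q (j + 1) := fun i j hi hj ↦
    mul_nonneg (hp _ (Finset.mem_Icc.2 ⟨by omega, by omega⟩))
      (hq _ (Finset.mem_Icc.2 ⟨by omega, by omega⟩))
  induction k with
  | zero =>
    have h00 := hpq 0 0 (by omega) (by omega)
    have h01 := hpq 0 1 (by omega) (by omega)
    have h10 := hpq 1 0 (by omega) (by omega)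
    simp [lazyUpdate] at *
    linarith
  | succ k ih =>
    have ih := ih (by omega)
    have h02 := hpq k (k + 2) (by omega) (by omega)
    have h20 := hpq (k + 2) k (by omega) (by omega)
    have interior (f : ℕ → ℝ) : lazyUpdate (n + 2) f (k + 1 + 1) =
        (1 / 4) * f (k + 1) + (1 / 2) * f (k + 2) + (1 / 4) * f (k + 3) := by
      unfold lazyUpdate
      rw [if_neg (by omega), if_neg (by omega)]
      rfl
    rw [Finset.sum_Icc_succ_top (by omega : 1 ≤ k + 1 + 1),
      Finset.sum_Icc_succ_top (by omega : 1 ≤ k + 1)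
        (fun μ ↦ p μ * q (μ + 1) + p (μ + 1) * q μ),
      Finset.sum_Icc_succ_top (by omega : 1 ≤ k + 1 + 1), interior, interior]
    simp only [add_assoc, Nat.reduceAdd] at *
    linarith

/-- For `N ≥ 2` and nonnegative functions `p, q` on `{1, …, N}`, writing `T`
for the lazy-walk update,
`Σ_{μ=1}^{N} (Tp)(μ)(Tq)(μ) ≥ (3/8) Σ_{μ=1}^{N} p(μ)q(μ)
  + (1/4) Σ_{μ=1}^{N-1} (p(μ)q(μ+1) + p(μ+1)q(μ))`. -/
theorem stmt_11 (N : ℕ) (hN : 2 ≤ N) (p q : ℕ → ℝ)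
    (hp : ∀ μ ∈ Finset.Icc 1 N, 0 ≤ p μ)
    (hq : ∀ μ ∈ Finset.Icc 1 N, 0 ≤ q μ) :
    (3 / 8) * ∑ μ ∈ Finset.Icc 1 N, p μ * q μ +
        (1 / 4) * ∑ μ ∈ Finset.Icc 1 (N - 1), (p μ * q (μ + 1) + p (μ + 1) * q μ) ≤
      ∑ μ ∈ Finset.Icc 1 N, lazyUpdate N p μ * lazyUpdate N q μ := by
  obtain ⟨n, rfl⟩ := Nat.exists_eq_add_of_le' hN
  have bulk := lazyUpdate_partial_overlap n p q hp hq n le_rfl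
  have hpq : ∀ i j, i ≤ n + 1 → j ≤ n + 1 → 0 ≤ p (i + 1) * q (j + 1) := fun i j hi hj ↦
    mul_nonneg (hp _ (Finset.mem_Icc.2 ⟨by omega, by omega⟩))
      (hq _ (Finset.mem_Icc.2 ⟨by omega, by omega⟩))
  have h01 := hpq n (n + 1) (by omega) le_rfl
  have h10 := hpq (n + 1) n le_rfl (by omega)
  have h11 := hpq (n + 1) (n + 1) le_rfl le_rfl
  have right (f : ℕ → ℝ) : lazyUpdate (n + 2) f (n + 1 + 1) =
      (3 / 4) * f (n + 2) + (1 / 4) * f (n + 1) := by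
    unfold lazyUpdate
    rw [if_neg (by omega), if_pos (by omega)]
    rfl
  rw [show n + 2 - 1 = n + 1 by omega, Finset.sum_Icc_succ_top (by omega : 1 ≤ n + 1 + 1),
    Finset.sum_Icc_succ_top (by omega : 1 ≤ n + 1)
        (fun μ ↦ p μ * q (μ + 1) + p (μ + 1) * q μ),
    Finset.sum_Icc_succ_top (by omega : 1 ≤ n + 1 + 1), right, right]
  simp only [add_assoc, Nat.reduceAdd] at *
  linarith
end

section
/- There exists a constant C > 0 such that for every natural number t ≥ 1 and every real x with 0 ≤ x ≤ π/2: 0 ≤ exp(−2tx²) − cos(x)^{4t} ≤ C · t · x⁴ · exp(−2tx²). -/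
open Real

lemma mul_cos_le_sin_of_nonneg {x : ℝ} (hx : 0 ≤ x) (hx' : x < π / 2) :
    x * cos x ≤ sin x := by
  have hc : 0 < cos x := cos_pos_of_mem_Ioo ⟨by linarith [pi_pos], hx'⟩
  have h := Real.le_tan hx hx'
  rwa [tan_eq_sin_div_cos, le_div_iff₀ hc] at h

lemma antitoneOn_cos_mul_exp_sq_div_two :
    AntitoneOn (fun x : ℝ => cos x * exp (x ^ 2 / 2)) (Set.Icc 0 (π / 2)) := by
  have hd : ∀ x : ℝ, HasDerivAt (fun x : ℝ => cos x * exp (x ^ 2 / 2))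
      ((x * cos x - sin x) * exp (x ^ 2 / 2)) x := fun x => by
    refine ((hasDerivAt_cos x).mul (((hasDerivAt_pow 2 x).div_const 2).exp)).congr_deriv ?_
    push_cast
    ring
  refine antitoneOn_of_deriv_nonpos (convex_Icc _ _)
    (fun x _ => (hd x).continuousAt.continuousWithinAt)
    (fun x _ => (hd x).differentiableAt.differentiableWithinAt) fun x hx => ?_
  rw [interior_Icc] at hx
  rw [(hd x).deriv]
  exact mul_nonpos_of_nonpos_of_nonneg
    (sub_nonpos.2 (mul_cos_le_sin_of_nonneg hx.1.le hx.2)) (exp_pos _).le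

lemma cos_mul_exp_sq_div_two_le_one {x : ℝ} (hx : 0 ≤ x) (hx' : x ≤ π / 2) :
    cos x * exp (x ^ 2 / 2) ≤ 1 := by
  simpa using antitoneOn_cos_mul_exp_sq_div_two
    (Set.left_mem_Icc.2 (hx.trans hx')) ⟨hx, hx'⟩ hx

lemma one_sub_pow_four_le_cos_mul_exp_pow_four (x : ℝ) :
    1 - x ^ 4 ≤ (cos x * exp (x ^ 2 / 2)) ^ 4 := by
  rcases le_total (x ^ 2) 2 with h | h
  · have hu : 1 + -(x ^ 4 / 4) ≤ cos x * exp (x ^ 2 / 2) :=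
      calc 1 + -(x ^ 4 / 4) = (1 - x ^ 2 / 2) * (x ^ 2 / 2 + 1) := by ring
        _ ≤ (1 - x ^ 2 / 2) * exp (x ^ 2 / 2) :=
          mul_le_mul_of_nonneg_left (add_one_le_exp _) (by linarith)
        _ ≤ cos x * exp (x ^ 2 / 2) :=
          mul_le_mul_of_nonneg_right one_sub_sq_div_two_le_cos (exp_pos _).le
    have h4 : x ^ 4 ≤ 4 := by nlinarith [sq_nonneg x]
    have hb := one_add_mul_le_pow (a := -(x ^ 4 / 4)) (by linarith) 4
    have hp := pow_le_pow_left₀ (by linarith) hu 4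
    push_cast at hb
    linarith
  · have hr : 0 ≤ (cos x * exp (x ^ 2 / 2)) ^ 4 := by positivity
    nlinarith

/-- There is a constant `C > 0` such that for every `t ≥ 1` and every real
`x ∈ [0, π/2]`, `0 ≤ exp(-2tx²) - cos(x)^{4t} ≤ C t x⁴ exp(-2tx²)`. -/
theorem stmt_15 :
    ∃ C : ℝ, 0 < C ∧
      ∀ t : ℕ, 1 ≤ t → ∀ x : ℝ, 0 ≤ x → x ≤ π / 2 →
        0 ≤ Real.exp (-(2 * (t : ℝ) * x ^ 2)) - Real.cos x ^ (4 * t) ∧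
        Real.exp (-(2 * (t : ℝ) * x ^ 2)) - Real.cos x ^ (4 * t) ≤
          C * (t : ℝ) * x ^ 4 * Real.exp (-(2 * (t : ℝ) * x ^ 2)) := by
  refine ⟨1, one_pos, fun t _ x hx hx' => ?_⟩
  set r := (cos x * exp (x ^ 2 / 2)) ^ 4 with hr
  have hc : 0 ≤ cos x := cos_nonneg_of_mem_Icc ⟨by linarith, hx'⟩
  have hr0 : 0 ≤ r := by positivity
  have hr1 : r ≤ 1 := pow_le_one₀ (by positivity) (cos_mul_exp_sq_div_two_le_one hx hx')
  have hcos : cos x ^ (4 * t) = exp (-(2 * (t : ℝ) * x ^ 2)) * r ^ t := by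
    have he : exp (-(2 * (t : ℝ) * x ^ 2)) * exp (x ^ 2 / 2) ^ (4 * t) = 1 := by
      rw [← exp_nat_mul, ← exp_add, exp_eq_one_iff]
      push_cast
      ring
    rw [hr, ← pow_mul, mul_pow, mul_left_comm, he, mul_one]
  have hE := exp_pos (-(2 * (t : ℝ) * x ^ 2))
  have hbern : 1 - r ^ t ≤ t * x ^ 4 := by
    have hb := one_add_mul_le_pow (a := r - 1) (by linarith) t
    rw [add_sub_cancel] at hb
    have hm := mul_le_mul_of_nonneg_left
      (one_sub_pow_four_le_cos_mul_exp_pow_four x) (Nat.cast_nonneg (α := ℝ) t)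
    rw [← hr] at hm
    linarith
  rw [hcos]
  constructor
  · nlinarith [pow_le_one₀ hr0 hr1 (n := t)]
  · nlinarith [mul_le_mul_of_nonneg_left hbern hE.le]
end

section
/- For every integer N ≥ 1, every real t > 0, and all integers i, j: −1/N + (1/N) · Σ_{k=0}^{∞} [cos((i−j)kπ/N) + cos((i+j−1)kπ/N)] · exp(−π²k²t/(2N²)) = (1/√(2πt)) · Σ_{k∈ℤ} (exp(−(2Nk + i − j)²/(2t)) + exp(−(2Nk + i + j − 1)²/(2t))). -/
open Real

open HurwitzZeta in
theorem hasSum_nat_cos_mul_exp (a : ℝ) {x : ℝ} (hx : 0 < x) :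
    HasSum (fun n : ℕ ↦ Real.cos (2 * π * a * n) * Real.exp (-π * (n : ℝ) ^ 2 * x))
      ((cosKernel a x + 1) / 2) := by
  rw [← hasSum_nat_add_iff' 1]
  have h := (hasSum_nat_cosKernel₀ a hx).div_const 2
  have hc : (cosKernel a x + 1) / 2 - ∑ i ∈ Finset.range 1,
      Real.cos (2 * π * a * (i : ℕ)) * Real.exp (-π * ((i : ℕ) : ℝ) ^ 2 * x) =
      (cosKernel a x - 1) / 2 := by
    simp
    ring
  rw [hc]
  have hf (n : ℕ) : 2 * Real.cos (2 * π * a * (n + 1)) * Real.exp (-π * (n + 1) ^ 2 * x) / 2 =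
      Real.cos (2 * π * a * (n + 1 : ℕ)) * Real.exp (-π * ((n + 1 : ℕ) : ℝ) ^ 2 * x) := by
    push_cast
    ring
  simpa only [hf] using h

open HurwitzZeta in
theorem hasSum_nat_cos_mul_exp_of_lattice {N t : ℝ} (hN : 0 < N) (ht : 0 < t) (m : ℝ) :
    HasSum (fun k : ℕ ↦ Real.cos (m * k * π / N) *
        Real.exp (-(π ^ 2 * (k : ℝ) ^ 2 * t) / (2 * N ^ 2)))
      ((cosKernel ↑(m / (2 * N)) (π * t / (2 * N ^ 2)) + 1) / 2) := by
  convert hasSum_nat_cos_mul_exp (m / (2 * N)) (x := π * t / (2 * N ^ 2)) (by positivity)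
    using 4 with k
  · field_simp
  · field_simp

open HurwitzZeta in
theorem hasSum_int_exp_of_lattice {N t : ℝ} (hN : 0 < N) (ht : 0 < t) (m : ℝ) :
    HasSum (fun k : ℤ ↦ Real.exp (-(2 * N * k + m) ^ 2 / (2 * t)))
      (Real.sqrt (2 * π * t) / (2 * N) *
        cosKernel ↑(m / (2 * N)) (π * t / (2 * N ^ 2))) := by
  have hx : 0 < 2 * N ^ 2 / (π * t) := by positivity
  convert hasSum_int_evenKernel (m / (2 * N)) hx using 1
  · ext k
    congr 1
    field_simp
  · rw [evenKernel_functional_equation, one_div_div, ← Real.sqrt_eq_rpow]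
    congr 1
    rw [div_eq_div_iff (by positivity) (by positivity), ← Real.sqrt_mul (by positivity), one_mul,
      ← Real.sqrt_sq (show 0 ≤ 2 * N by positivity)]
    congr 1
    field_simp

/-- Poisson-summation identity for the Gaussian-substituted mode sum: for
`N ≥ 1`, real `t > 0` and integers `i, j`,
`-1/N + (1/N) Σ_{k=0}^{∞} [cos((i-j)kπ/N) + cos((i+j-1)kπ/N)] exp(-π²k²t/(2N²))
  = (1/√(2πt)) Σ_{k∈ℤ} (exp(-(2Nk+i-j)²/(2t)) + exp(-(2Nk+i+j-1)²/(2t)))`. -/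
theorem stmt_18 (N : ℕ) (hN : 1 ≤ N) (t : ℝ) (ht : 0 < t) (i j : ℤ) :
    -(1 / (N : ℝ)) + (1 / (N : ℝ)) *
        ∑' k : ℕ,
          (Real.cos (((i - j : ℤ) : ℝ) * (k : ℝ) * π / N) +
              Real.cos (((i + j - 1 : ℤ) : ℝ) * (k : ℝ) * π / N)) *
            Real.exp (-(π ^ 2 * (k : ℝ) ^ 2 * t) / (2 * (N : ℝ) ^ 2)) =
      (1 / Real.sqrt (2 * π * t)) *
        ∑' k : ℤ,
          (Real.exp (-(2 * (N : ℝ) * (k : ℝ) + ((i - j : ℤ) : ℝ)) ^ 2 / (2 * t)) +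
            Real.exp (-(2 * (N : ℝ) * (k : ℝ) + ((i + j - 1 : ℤ) : ℝ)) ^ 2 / (2 * t))) := by
  have hN' : (0 : ℝ) < N := by exact_mod_cast hN
  have hs : 0 < Real.sqrt (2 * π * t) := by positivity
  simp only [add_mul]
  rw [((hasSum_nat_cos_mul_exp_of_lattice hN' ht _).add
      (hasSum_nat_cos_mul_exp_of_lattice hN' ht _)).tsum_eq,
    ((hasSum_int_exp_of_lattice hN' ht _).add (hasSum_int_exp_of_lattice hN' ht _)).tsum_eq]
  field_simp
  ring
end

section
/- There exists a constant C > 0 such that for all integers N ≥ 2, t ≥ 1, and 1 ≤ i, j ≤ N, the quantity ζ₀(t) := 1/N + (1/N) · Σ_{k=1}^{N−1} [cos((i−j)kπ/N) + cos((i+j−1)kπ/N)] · cos(πk/(2N))^{4t} satisfies |ζ₀(t) − (1/√(2πt)) · Σ_{k∈ℤ} (exp(−(2Nk + i − j)²/(2t)) + exp(−(2Nk + i + j − 1)²/(2t)))| ≤ C/t. -/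
open Real Finset

lemma cos_le_exp_neg_sq_div_two {θ : ℝ} (h0 : 0 ≤ θ) (h1 : θ ≤ π / 2) :
    cos θ ≤ exp (-θ ^ 2 / 2) := by
  have hd : ∀ x : ℝ, HasDerivAt (fun x : ℝ ↦ cos x * exp (x ^ 2 / 2))
      ((x * cos x - sin x) * exp (x ^ 2 / 2)) x := fun x ↦ by
    convert! (hasDerivAt_cos x).mul (((hasDerivAt_pow 2 x).div_const 2).exp) using 1
    simp
    ring
  have hanti : AntitoneOn (fun x : ℝ ↦ cos x * exp (x ^ 2 / 2)) (Set.Icc 0 (π / 2)) := by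
    refine antitoneOn_of_deriv_nonpos (convex_Icc _ _)
      (fun x _ ↦ (hd x).continuousAt.continuousWithinAt)
      (fun x _ ↦ (hd x).differentiableAt.differentiableWithinAt) fun x hx ↦ ?_
    rw [interior_Icc] at hx
    rw [(hd x).deriv]
    have hc : 0 < cos x := cos_pos_of_mem_Ioo ⟨by linarith [hx.1, pi_pos], hx.2⟩
    have ht := Real.lt_tan hx.1 hx.2
    rw [tan_eq_sin_div_cos, lt_div_iff₀ hc] at ht
    exact mul_nonpos_of_nonpos_of_nonneg (by linarith) (exp_pos _).le
  have h := hanti ⟨le_rfl, by positivity⟩ ⟨h0, h1⟩ h0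
  simp only [cos_zero, ne_eq, OfNat.ofNat_ne_zero, not_false_eq_true, zero_pow, zero_div,
    exp_zero, mul_one] at h
  rw [neg_div, exp_neg, ← one_div, le_div_iff₀ (exp_pos _)]
  exact h

lemma exp_neg_le_one_sub_add_sq_div_two {y : ℝ} (hy : 0 ≤ y) :
    exp (-y) ≤ 1 - y + y ^ 2 / 2 := by
  have h := quadratic_le_exp_of_nonneg hy
  rw [exp_neg, inv_le_iff_one_le_mul₀ (exp_pos _)]
  have h2 : 0 ≤ 1 - y + y ^ 2 / 2 := by nlinarith [sq_nonneg (y - 1)]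
  nlinarith [mul_le_mul_of_nonneg_left h h2, sq_nonneg (y ^ 2)]

lemma sq_mul_exp_neg_le_two {u : ℝ} (hu : 0 ≤ u) : u ^ 2 * exp (-u) ≤ 2 := by
  have h := quadratic_le_exp_of_nonneg hu
  rw [exp_neg, ← div_eq_mul_inv, div_le_iff₀ (exp_pos _)]
  nlinarith

/-- The Gaussian approximation of a high power of the cosine. -/
lemma abs_cos_pow_sub_exp_le {θ : ℝ} (h0 : 0 ≤ θ) (h1 : θ ≤ π / 2) {t : ℕ} (ht : 1 ≤ t) :
    |cos θ ^ (4 * t) - exp (-(2 * t * θ ^ 2))| ≤ 1 / t := by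
  have hb : 0 ≤ cos θ := cos_nonneg_of_mem_Icc ⟨by linarith [pi_pos], h1⟩
  have hba := cos_le_exp_neg_sq_div_two h0 h1
  have hab : exp (-θ ^ 2 / 2) - cos θ ≤ θ ^ 4 / 8 := by
    have h2 := exp_neg_le_one_sub_add_sq_div_two (y := θ ^ 2 / 2) (by positivity)
    have h3 := one_sub_sq_div_two_le_cos (x := θ)
    rw [← neg_div] at h2
    nlinarith
  have htr : (1 : ℝ) ≤ t := by exact_mod_cast ht
  have hpow : exp (-(2 * t * θ ^ 2)) = exp (-θ ^ 2 / 2) ^ (4 * t) := by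
    rw [← exp_nat_mul]
    push_cast
    ring_nf
  have hpow' : exp (-θ ^ 2 / 2) ^ (4 * t - 1) ≤ exp (-(t * θ ^ 2)) := by
    rw [← exp_nat_mul, exp_le_exp, Nat.cast_sub (by lia)]
    push_cast
    nlinarith [mul_nonneg (sub_nonneg.2 htr) (sq_nonneg θ), sq_nonneg θ]
  rw [hpow, abs_sub_comm]
  have hmax : max |exp (-θ ^ 2 / 2)| |cos θ| = exp (-θ ^ 2 / 2) := by
    rw [abs_of_nonneg hb, abs_of_pos (exp_pos _), max_eq_left hba]
  calc |exp (-θ ^ 2 / 2) ^ (4 * t) - cos θ ^ (4 * t)|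
      ≤ (exp (-θ ^ 2 / 2) - cos θ) * (4 * t : ℕ) * exp (-θ ^ 2 / 2) ^ (4 * t - 1) := by
        refine (abs_pow_sub_pow_le _ _ _).trans_eq ?_
        rw [hmax, abs_of_nonneg (sub_nonneg.2 hba)]
    _ ≤ θ ^ 4 / 8 * (4 * t : ℕ) * exp (-(t * θ ^ 2)) := by gcongr
    _ = 1 / (2 * t) * ((t * θ ^ 2) ^ 2 * exp (-(t * θ ^ 2))) := by
        push_cast
        field_simp
        ring
    _ ≤ 1 / (2 * t) * 2 := by
        gcongr
        exact sq_mul_exp_neg_le_two (by positivity)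
    _ = 1 / t := by field_simp

lemma summable_exp_neg_mul_int_sq {c : ℝ} (hc : 0 < c) :
    Summable fun n : ℤ ↦ exp (-(c * (n : ℝ) ^ 2)) := by
  refine (summable_pow_mul_jacobiTheta₂_term_bound 0 (div_pos hc pi_pos) 0).congr fun n ↦ ?_
  simp only [pow_zero, one_mul, mul_zero, zero_mul, sub_zero]
  congr 1
  field_simp

lemma summable_exp_neg_mul_int_add_sq {c : ℝ} (hc : 0 < c) (y : ℝ) :
    Summable fun n : ℤ ↦ exp (-(c * ((n : ℝ) + y) ^ 2)) := by
  refine Summable.of_nonneg_of_le (fun _ ↦ (exp_pos _).le) (fun n ↦ ?_)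
    ((summable_exp_neg_mul_int_sq (half_pos hc)).mul_left (exp (c * y ^ 2)))
  rw [← exp_add, exp_le_exp]
  nlinarith [mul_nonneg hc.le (sq_nonneg ((n : ℝ) + 2 * y))]

/-- Poisson summation for a shifted Gaussian, in real form. -/
lemma tsum_exp_neg_int_add_sq {a : ℝ} (ha : 0 < a) (y : ℝ) :
    ∑' n : ℤ, exp (-(π / a * ((n : ℝ) + y) ^ 2)) =
      √a * ∑' n : ℤ, exp (-(π * a * (n : ℝ) ^ 2)) * cos (2 * π * y * n) := by
  have key := Complex.tsum_exp_neg_quadratic (a := (a : ℂ)) (by simpa using ha)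
    (-Complex.I * (y : ℂ))
  have hR : ∀ n : ℤ, Complex.exp (-π / a * (n + Complex.I * (-Complex.I * y)) ^ 2) =
      ((exp (-(π / a * ((n : ℝ) + y) ^ 2)) : ℝ) : ℂ) := fun n ↦ by
    have : Complex.I * (-Complex.I * y) = (y : ℂ) := by
      rw [← mul_assoc, mul_neg, Complex.I_mul_I]
      simp
    rw [this]
    push_cast
    ring_nf
  have hL : ∀ n : ℤ, Complex.exp (-π * a * n ^ 2 + 2 * π * (-Complex.I * y) * n) =
      ((exp (-(π * a * (n : ℝ) ^ 2)) : ℝ) : ℂ) *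
        Complex.exp (((-(2 * π * y * n) : ℝ) : ℂ) * Complex.I) := fun n ↦ by
    rw [Complex.ofReal_exp, ← Complex.exp_add]
    push_cast
    ring_nf
  have hsum : Summable fun n : ℤ ↦ ((exp (-(π * a * (n : ℝ) ^ 2)) : ℝ) : ℂ) *
      Complex.exp (((-(2 * π * y * n) : ℝ) : ℂ) * Complex.I) := by
    refine Summable.of_norm ((summable_exp_neg_mul_int_sq (mul_pos pi_pos ha)).congr fun n ↦ ?_)
    rw [norm_mul, Complex.norm_exp_ofReal_mul_I, Complex.norm_real, mul_one, norm_of_nonneg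
      (exp_pos _).le]
  have hsqrt : (1 : ℂ) / (a : ℂ) ^ (1 / 2 : ℂ) = ((1 / √a : ℝ) : ℂ) := by
    rw [sqrt_eq_rpow, Complex.ofReal_div, Complex.ofReal_cpow ha.le]
    simp
  simp_rw [hR, hL, hsqrt, ← Complex.ofReal_tsum, ← Complex.ofReal_mul] at key
  have hre := congrArg Complex.re key
  rw [Complex.re_tsum hsum, Complex.ofReal_re] at hre
  simp_rw [Complex.re_ofReal_mul, Complex.exp_ofReal_mul_I_re, cos_neg] at hre
  rw [hre]
  have := sqrt_pos.2 ha
  field_simp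

lemma tsum_exp_neg_mul_nat_add_sq_le {N : ℕ} (hN : 0 < N) {t : ℝ} (ht : 0 < t) {f : ℕ → ℝ}
    (hf : ∀ m, |f m| ≤ exp (-(π * (π * t / (2 * N ^ 2)) * ((m + N : ℕ) : ℝ) ^ 2))) :
    |∑' m, f m| ≤ exp (-t) * (1 + N / t) := by
  have hNr : (0 : ℝ) < N := by exact_mod_cast hN
  have hc : 0 < t / N := by positivity
  have hr1 : exp (-(t / N)) < 1 := by simpa using hc
  have hbound : ∀ m, ‖f m‖ ≤ exp (-t) * exp (-(t / N)) ^ m := fun m ↦ by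
    refine (hf m).trans ?_
    rw [← exp_nat_mul, ← exp_add, exp_le_exp]
    have h1 : π * (π * t / (2 * N ^ 2)) * ((m + N : ℕ) : ℝ) ^ 2 =
        (π ^ 2 / 2) * (t / N ^ 2 * ((m : ℝ) + N) ^ 2) := by
      push_cast
      field_simp
    have h2 : t + m * (t / N) = t / N ^ 2 * (N ^ 2 + m * N) := by field_simp
    have h3 : t / N ^ 2 * (N ^ 2 + m * N) ≤ t / N ^ 2 * ((m : ℝ) + N) ^ 2 := by
      gcongr
      nlinarith [mul_nonneg (Nat.cast_nonneg (α := ℝ) m) hNr.le, sq_nonneg (m : ℝ)]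
    have h4 : 1 ≤ π ^ 2 / 2 := by nlinarith [pi_gt_three]
    have h5 : 0 ≤ t / N ^ 2 * ((m : ℝ) + N) ^ 2 := by positivity
    nlinarith
  have hgeo := (hasSum_geometric_of_lt_one (exp_pos _).le hr1).mul_left (exp (-t))
  refine (tsum_of_norm_bounded hgeo hbound).trans ?_
  gcongr
  have h6 : exp (-(t / N)) * (1 + t / N) ≤ 1 := by
    rw [exp_neg, inv_mul_le_iff₀ (exp_pos _)]
    linarith [add_one_le_exp (t / N)]
  have h7 : (1 : ℝ) + N / t = (1 + t / N) / (t / N) := by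
    field_simp
    ring
  rw [h7, inv_le_comm₀ (by linarith) (by positivity), inv_div, div_le_iff₀ (by positivity)]
  nlinarith

lemma tsum_gaussian_eq_sum_add_tsum {N : ℕ} (hN : 0 < N) {t : ℝ} (ht : 0 < t) (x : ℝ) :
    (1 / √(2 * π * t)) * ∑' k : ℤ, exp (-(2 * (N : ℝ) * (k : ℝ) + x) ^ 2 / (2 * t)) =
      1 / (2 * N) + 1 / N * ((∑ k ∈ Icc 1 (N - 1),
        exp (-(π * (π * t / (2 * N ^ 2)) * (k : ℝ) ^ 2)) * cos (x * k * π / N)) +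
        ∑' m : ℕ, exp (-(π * (π * t / (2 * N ^ 2)) * ((m + N : ℕ) : ℝ) ^ 2)) *
          cos (x * (m + N : ℕ) * π / N)) := by
  have hNr : (0 : ℝ) < N := by exact_mod_cast hN
  have ha : 0 < π * t / (2 * (N : ℝ) ^ 2) := by positivity
  have hP := tsum_exp_neg_int_add_sq ha (x / (2 * N))
  set a := π * t / (2 * (N : ℝ) ^ 2) with ha_def
  have hterm : ∀ k : ℤ, exp (-(2 * (N : ℝ) * (k : ℝ) + x) ^ 2 / (2 * t)) =
      exp (-(π / a * ((k : ℝ) + x / (2 * N)) ^ 2)) := fun k ↦ by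
    rw [ha_def]
    congr 1
    field_simp
  simp_rw [hterm]
  rw [hP, ← mul_assoc]
  have hcoef : 1 / √(2 * π * t) * √a = 1 / (2 * N) := by
    have : a = 2 * π * t / (2 * N) ^ 2 := by
      rw [ha_def]
      field_simp
    rw [this, sqrt_div' _ (by positivity), sqrt_sq (by positivity)]
    have : 0 < √(2 * π * t) := by positivity
    field_simp
  rw [hcoef]
  let f : ℤ → ℝ := fun n ↦ exp (-(π * a * (n : ℝ) ^ 2)) * cos (2 * π * (x / (2 * N)) * n)
  have hfs : Summable f := by
    refine (summable_exp_neg_mul_int_sq (mul_pos pi_pos ha)).of_norm_bounded fun n ↦ ?_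
    rw [norm_mul, norm_of_nonneg (exp_pos _).le]
    exact mul_le_of_le_one_right (exp_pos _).le (abs_cos_le_one _)
  have hfe : f.Even := fun n ↦ by simp [f]
  have hcast : ∀ k : ℕ, f k = exp (-(π * a * (k : ℝ) ^ 2)) * cos (x * k * π / N) := fun k ↦ by
    simp only [f, Int.cast_natCast]
    congr 2
    field_simp
  have hnat : Summable fun n : ℕ ↦ f n := hfs.comp_injective Nat.cast_injective
  have hsplit : ∑' n : ℤ, f n =
      1 + 2 * ((∑ k ∈ Icc 1 (N - 1), f k) + ∑' m : ℕ, f ((m + N : ℕ) : ℤ)) := by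
    rw [tsum_int_eq_zero_add_two_mul_tsum_pnat hfe hfs]
    have h0 : f 0 = 1 := by simp [f]
    have h1 : ∑' n : ℕ+, f n = ∑' n : ℕ, f ((n + 1 : ℕ) : ℤ) :=
      tsum_pnat_eq_tsum_succ (f := fun n : ℕ ↦ f n)
    have h2 := hnat.sum_add_tsum_nat_add N
    have h3 := hnat.sum_add_tsum_nat_add 1
    have h4 : ∑ k ∈ range N, f (k : ℤ) = 1 + ∑ k ∈ Icc 1 (N - 1), f k := by
      rw [← h0, range_eq_Ico, sum_eq_sum_Ico_succ_bot hN]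
      congr 2
    rw [h4] at h2
    rw [sum_range_one, Nat.cast_zero, h0] at h3
    rw [h0, h1]
    simp only [nsmul_eq_mul, Nat.cast_ofNat] at *
    linarith
  change 1 / (2 * (N : ℝ)) * ∑' n : ℤ, f n = _
  rw [hsplit]
  simp_rw [hcast]
  ring

/-- One half of the estimate: a cosine mode sum against the periodised Gaussian. -/
lemma abs_mode_sum_sub_gaussian_le {N t : ℕ} (hN : 0 < N) (ht : 1 ≤ t) (x : ℝ) :
    |(1 / (2 * (N : ℝ)) + 1 / N * ∑ k ∈ Icc 1 (N - 1),
        cos (x * k * π / N) * cos (π * k / (2 * N)) ^ (4 * t)) -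
      (1 / √(2 * π * t)) * ∑' k : ℤ, exp (-(2 * (N : ℝ) * (k : ℝ) + x) ^ 2 / (2 * t))| ≤
      3 / t := by
  have hNr : (1 : ℝ) ≤ N := by exact_mod_cast hN
  have htr : (1 : ℝ) ≤ t := by exact_mod_cast ht
  have htr0 : (0 : ℝ) < t := by linarith
  rw [tsum_gaussian_eq_sum_add_tsum hN htr0 x]
  set T := ∑' m : ℕ, exp (-(π * (π * t / (2 * N ^ 2)) * ((m + N : ℕ) : ℝ) ^ 2)) *
    cos (x * (m + N : ℕ) * π / N)
  have hTb : |T| ≤ exp (-t) * (1 + N / t) := by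
    refine tsum_exp_neg_mul_nat_add_sq_le hN htr0 fun m ↦ ?_
    rw [abs_mul, abs_of_pos (exp_pos _)]
    exact mul_le_of_le_one_right (exp_pos _).le (abs_cos_le_one _)
  have hTN : |T| ≤ N * (2 / t) := by
    have he : exp (-(t : ℝ)) ≤ 1 / t := by
      rw [exp_neg, ← one_div]
      exact one_div_le_one_div_of_le htr0 (by linarith [add_one_le_exp (t : ℝ)])
    have he1 : exp (-(t : ℝ)) ≤ 1 := by simp
    calc |T| ≤ exp (-t) * 1 + exp (-t) * (N / t) := by rw [← mul_add]; exact hTb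
      _ ≤ 1 / t * N + 1 * (N / t) := by gcongr
      _ = N * (2 / t) := by ring
  have hS : |∑ k ∈ Icc 1 (N - 1), (cos (x * k * π / N) * cos (π * k / (2 * N)) ^ (4 * t) -
      exp (-(π * (π * t / (2 * N ^ 2)) * (k : ℝ) ^ 2)) * cos (x * k * π / N))| ≤
      N * (1 / t) := by
    refine (abs_sum_le_sum_abs _ _).trans ((sum_le_card_nsmul _ _ (1 / (t : ℝ)) ?_).trans ?_)
    · intro k hk
      rw [mem_Icc] at hk
      have hkN : (k : ℝ) ≤ N := by exact_mod_cast (by lia : k ≤ N)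
      have h := abs_cos_pow_sub_exp_le (θ := π * k / (2 * N)) (by positivity)
        (by
          rw [div_le_div_iff₀ (by positivity) two_pos]
          nlinarith [pi_pos]) ht
      have hexp : π * (π * t / (2 * N ^ 2)) * (k : ℝ) ^ 2 = 2 * t * (π * k / (2 * N)) ^ 2 := by
        field_simp
      rw [hexp, mul_comm (exp _), ← mul_sub, abs_mul]
      exact (mul_le_of_le_one_left (abs_nonneg _) (abs_cos_le_one _)).trans h
    · rw [nsmul_eq_mul, Nat.card_Icc]
      gcongr
      lia
  rw [sum_sub_distrib] at hS
  set A := ∑ k ∈ Icc 1 (N - 1), cos (x * k * π / N) * cos (π * k / (2 * N)) ^ (4 * t)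
  set B := ∑ k ∈ Icc 1 (N - 1),
    exp (-(π * (π * t / (2 * N ^ 2)) * (k : ℝ) ^ 2)) * cos (x * k * π / N)
  have heq : 1 / (2 * (N : ℝ)) + 1 / N * A - (1 / (2 * N) + 1 / N * (B + T)) =
      (A - B - T) / N := by ring
  rw [heq, abs_div, abs_of_pos (by linarith : (0 : ℝ) < N), div_le_iff₀ (by linarith)]
  calc |A - B - T| ≤ |A - B| + |T| := abs_sub _ _
    _ ≤ N * (1 / t) + N * (2 / t) := add_le_add hS hTN
    _ = 3 / t * N := by ring

/-- Quantitative theta-function approximation of the diagonal collision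
probability of two lazy random walkers: there is a constant `C > 0` such that
for all `N ≥ 2`, `t ≥ 1` and `1 ≤ i, j ≤ N`, the mode sum
`ζ₀(t) = 1/N + (1/N) Σ_{k=1}^{N-1} [cos((i-j)kπ/N) + cos((i+j-1)kπ/N)] cos(πk/(2N))^{4t}`
is within `C/t` of
`(1/√(2πt)) Σ_{k∈ℤ} (exp(-(2Nk+i-j)²/(2t)) + exp(-(2Nk+i+j-1)²/(2t)))`. -/
theorem stmt_19 :
    ∃ C : ℝ, 0 < C ∧
      ∀ N t i j : ℕ, 2 ≤ N → 1 ≤ t → 1 ≤ i → i ≤ N → 1 ≤ j → j ≤ N →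
        |(1 / (N : ℝ) + (1 / (N : ℝ)) *
              ∑ k ∈ Finset.Icc 1 (N - 1),
                (Real.cos (((i : ℝ) - (j : ℝ)) * (k : ℝ) * π / N) +
                    Real.cos (((i : ℝ) + (j : ℝ) - 1) * (k : ℝ) * π / N)) *
                  Real.cos (π * (k : ℝ) / (2 * N)) ^ (4 * t)) -
            (1 / Real.sqrt (2 * π * t)) *
              ∑' k : ℤ,
                (Real.exp (-(2 * (N : ℝ) * (k : ℝ) + ((i : ℝ) - (j : ℝ))) ^ 2 / (2 * t)) +
                  Real.exp
                    (-(2 * (N : ℝ) * (k : ℝ) + ((i : ℝ) + (j : ℝ) - 1)) ^ 2 / (2 * t)))| ≤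
          C / t := by
  refine ⟨6, by norm_num, fun N t i j hN ht _ _ _ _ ↦ ?_⟩
  have h1 := abs_mode_sum_sub_gaussian_le (N := N) (by lia) ht ((i : ℝ) - j)
  have h2 := abs_mode_sum_sub_gaussian_le (N := N) (by lia) ht ((i : ℝ) + j - 1)
  have hNr : (0 : ℝ) < N := by exact_mod_cast (by lia : 0 < N)
  have htr : (0 : ℝ) < t := by exact_mod_cast ht
  have hs : ∀ x : ℝ, Summable fun k : ℤ ↦
      exp (-(2 * (N : ℝ) * (k : ℝ) + x) ^ 2 / (2 * t)) := fun x ↦ by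
    refine (summable_exp_neg_mul_int_add_sq (c := 2 * N ^ 2 / t) (by positivity)
      (x / (2 * N))).congr fun k ↦ ?_
    congr 1
    field_simp
  rw [(hs _).tsum_add (hs _)]
  simp_rw [add_mul, sum_add_distrib]
  refine le_of_eq_of_le (congrArg _ ?_) ((abs_add_le _ _).trans ((add_le_add h1 h2).trans_eq ?_))
  · ring
  · ring
end
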